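/- Let X be an infinite T1 topological space. Then ψ(X) ≤ nu_s(X)·2^(s(X)) (cardinal arithmetic). -/

import Mathlib

open Cardinal Set

/-- A nonempty subset `A` of a topological space is finitely non-Hausdorff if for every
nonempty finite subset `F` of `A` and every choice of open neighborhoods of the points
of `F`, the intersection of these neighborhoods is nonempty. -/
def FinNonHausdorff (X : Type*) [TopologicalSpace X] (A : Set X) : Prop :=
  A.Nonempty ∧ ∀ F : Finset X, (F : Set X) ⊆ A → F.Nonempty →
    ∀ U : X → Set X, (∀ x ∈ F, IsOpen (U x) ∧ x ∈ U x) →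
      (⋂ x ∈ F, U x).Nonempty

/-- A maximal finitely non-Hausdorff subset. -/
def MaxFinNonHausdorff (X : Type*) [TopologicalSpace X] (A : Set X) : Prop :=
  FinNonHausdorff X A ∧ ∀ B : Set X, FinNonHausdorff X B → A ⊆ B → A = B

/-- The non-Hausdorff number `nh(X)`. -/
noncomputable def nh (X : Type*) [TopologicalSpace X] : Cardinal :=
  1 + ⨆ A : {A : Set X // FinNonHausdorff X A}, #A.1

/-- A nonempty subset `A` is finitely non-Urysohn if for every nonempty finite subset `F`
of `A` and every choice of open neighborhoods of the points of `F`, the intersection of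
the closures of these neighborhoods is nonempty. -/
def FinNonUrysohn (X : Type*) [TopologicalSpace X] (A : Set X) : Prop :=
  A.Nonempty ∧ ∀ F : Finset X, (F : Set X) ⊆ A → F.Nonempty →
    ∀ U : X → Set X, (∀ x ∈ F, IsOpen (U x) ∧ x ∈ U x) →
      (⋂ x ∈ F, closure (U x)).Nonempty

/-- The non-Urysohn number `nu(X)`. -/
noncomputable def nu (X : Type*) [TopologicalSpace X] : Cardinal :=
  1 + ⨆ A : {A : Set X // FinNonUrysohn X A}, #A.1

/-- The θ-closure of the singleton `{x}`. -/
def thetaClosSingleton (X : Type*) [TopologicalSpace X] (x : X) : Set X :=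
  {y | ∀ U : Set X, IsOpen U → y ∈ U → x ∈ closure U}

/-- The non-Urysohn number of `X` with respect to singletons, `nu_s(X)`. -/
noncomputable def nuS (X : Type*) [TopologicalSpace X] : Cardinal :=
  1 + ⨆ x : X, #(thetaClosSingleton X x)

/-- The cellularity `c(X)`. -/
noncomputable def cellularity (X : Type*) [TopologicalSpace X] : Cardinal :=
  ℵ₀ + ⨆ 𝒰 : {𝒰 : Set (Set X) //
      (∀ U ∈ 𝒰, IsOpen U ∧ U.Nonempty) ∧ 𝒰.PairwiseDisjoint id}, #𝒰.1

/-- The character `χ(X)`. -/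
noncomputable def character (X : Type*) [TopologicalSpace X] : Cardinal :=
  ⨆ x : X, sInf {c : Cardinal | ∃ B : Set (Set X), #B = c ∧
    (∀ U ∈ B, IsOpen U ∧ x ∈ U) ∧ ∀ V : Set X, IsOpen V → x ∈ V → ∃ U ∈ B, U ⊆ V}

/-- The spread `s(X)`. -/
noncomputable def spread (X : Type*) [TopologicalSpace X] : Cardinal :=
  ℵ₀ + ⨆ D : {D : Set X // DiscreteTopology D}, #D.1

/-- The pseudocharacter `ψ(X)` of a `T₁` space. -/
noncomputable def pseudoCharacter (X : Type*) [TopologicalSpace X] : Cardinal :=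
  ⨆ x : X, sInf {c : Cardinal | ∃ S : Set (Set X), #S = c ∧
    (∀ U ∈ S, IsOpen U) ∧ ⋂₀ S = {x}}

/-- Shapirovskii's lemma: if every point `y` of `Y` has an assigned open neighbourhood `U y`,
then some discrete `A ⊆ Y` satisfies `Y ⊆ closure A ∪ ⋃ a ∈ A, U a`. -/
theorem exists_discrete_subset_closure_union {X : Type*} [TopologicalSpace X] (Y : Set X)
    (U : X → Set X) (hU : ∀ y ∈ Y, IsOpen (U y) ∧ y ∈ U y) :
    ∃ A ⊆ Y, DiscreteTopology A ∧ Y ⊆ closure A ∪ ⋃ a ∈ A, U a := by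
  let r : X → X → Prop := WellOrderingRel
  have wf : WellFounded r := WellOrderingRel.isWellOrder.wf
  let step (y : X) (ih : ∀ b, r b y → Prop) : Prop :=
    y ∈ Y ∧ y ∉ closure {b | ∃ h : r b y, ih b h} ∧ ∀ b, ∀ h : r b y, ih b h → y ∉ U b
  let A : Set X := {y | wf.fix step y}
  have hA (y : X) : y ∈ A ↔
      y ∈ Y ∧ y ∉ closure {b | r b y ∧ b ∈ A} ∧ ∀ b, r b y → b ∈ A → y ∉ U b := by
    change wf.fix step y ↔ _
    rw [wf.fix_eq]
    simp only [step, A, mem_ofPred_eq, exists_prop]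
  refine ⟨A, fun y hy => ((hA y).1 hy).1, ?_, ?_⟩
  · refine discreteTopology_subtype_iff'.2 fun y hy => ?_
    obtain ⟨hyY, hycl, -⟩ := (hA y).1 hy
    refine ⟨U y ∩ (closure {b | r b y ∧ b ∈ A})ᶜ,
      (hU y hyY).1.inter isClosed_closure.isOpen_compl, ?_⟩
    ext z
    simp only [mem_inter_iff, mem_compl_iff, mem_singleton_iff]
    constructor
    · rintro ⟨⟨hzU, hzcl⟩, hzA⟩
      rcases trichotomous_of r z y with h | h | h
      · exact (hzcl (subset_closure ⟨h, hzA⟩)).elim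
      · exact h
      · exact absurd hzU (((hA z).1 hzA).2.2 y h hy)
    · rintro rfl
      exact ⟨⟨(hU z hyY).2, hycl⟩, hy⟩
  · intro y hyY
    by_contra hy
    simp only [mem_union, mem_iUnion, not_or, not_exists] at hy
    exact hy.1 <| subset_closure <| (hA y).2
      ⟨hyY, fun h => hy.1 (closure_mono (fun _ hb => hb.2) h), fun b _ hb => hy.2 b hb⟩

theorem mk_thetaClosSingleton_le_nuS {X : Type*} [TopologicalSpace X] (x : X) :
    #(thetaClosSingleton X x) ≤ nuS X :=
  (le_ciSup (f := fun x : X => #(thetaClosSingleton X x)) bddAbove_of_small x).trans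
    le_add_self

theorem mk_le_spread {X : Type*} [TopologicalSpace X] (D : Set X) (hD : DiscreteTopology D) :
    #D ≤ spread X :=
  (le_ciSup (f := fun D : {D : Set X // DiscreteTopology D} => #D.1)
    bddAbove_of_small ⟨D, hD⟩).trans le_add_self

/-- The points outside the θ-closure of `x` can be separated from `x` by at most
`2 ^ spread X` open sets. -/
theorem exists_openNhds_inter_subset_thetaClos {X : Type*} [TopologicalSpace X] (x : X) :
    ∃ S : Set (Set X), #S ≤ 2 ^ spread X ∧ (∀ V ∈ S, IsOpen V ∧ x ∈ V) ∧
      ⋂₀ S ⊆ thetaClosSingleton X x := by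
  have hsep : ∀ y ∈ (thetaClosSingleton X x)ᶜ, ∃ U : Set X, IsOpen U ∧ y ∈ U ∧ x ∉ closure U := by
    intro y hy
    simpa [thetaClosSingleton] using hy
  choose! U hUo hyU hxU using hsep
  obtain ⟨A, hAY, hAd, hcov⟩ := exists_discrete_subset_closure_union
    (thetaClosSingleton X x)ᶜ U fun y hy => ⟨hUo y hy, hyU y hy⟩
  have hA : #A ≤ spread X := mk_le_spread A hAd
  have hs : ℵ₀ ≤ spread X := le_self_add
  refine ⟨(fun a => (closure (U a))ᶜ) '' A ∪
    (fun B => (closure B)ᶜ) '' {B ∈ 𝒫 A | x ∉ closure B}, ?_, ?_, ?_⟩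
  · refine (mk_union_le _ _).trans
      (add_le_of_le (hs.trans (cantor _).le) (mk_image_le.trans (hA.trans (cantor _).le)) ?_)
    calc _ ≤ #{B ∈ 𝒫 A | x ∉ closure B} := mk_image_le
      _ ≤ #(𝒫 A) := mk_le_mk_of_subset (sep_subset _ _)
      _ = 2 ^ #A := mk_powerset A
      _ ≤ 2 ^ spread X := power_le_power_left two_ne_zero hA
  · rintro _ (⟨a, ha, rfl⟩ | ⟨B, hB, rfl⟩)
    · exact ⟨isClosed_closure.isOpen_compl, hxU a (hAY ha)⟩
    · exact ⟨isClosed_closure.isOpen_compl, hB.2⟩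
  · intro y hy
    by_contra hyT
    rcases hcov hyT with h | h
    · refine hy _ (.inr ⟨A ∩ U y, ⟨inter_subset_left,
        fun hx => hxU y hyT (closure_mono inter_subset_right hx)⟩, rfl⟩) ?_
      rw [inter_comm]
      exact (hUo y hyT).inter_closure ⟨hyU y hyT, h⟩
    · obtain ⟨a, ha, hya⟩ := mem_iUnion₂.1 h
      exact hy _ (.inl ⟨a, ha, rfl⟩) (subset_closure hya)

theorem pseudoCharacter_le {X : Type*} [TopologicalSpace X] {κ : Cardinal}
    (h : ∀ x : X, ∃ S : Set (Set X), #S ≤ κ ∧ (∀ U ∈ S, IsOpen U) ∧ ⋂₀ S = {x}) :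
    pseudoCharacter X ≤ κ := by
  refine ciSup_le' fun x => ?_
  obtain ⟨S, hS, hSo, hSx⟩ := h x
  exact (csInf_le' (mem_ofPred.2 ⟨S, rfl, hSo, hSx⟩)).trans hS

theorem statement5 (X : Type*) [TopologicalSpace X] [T1Space X] [Infinite X] :
    pseudoCharacter X ≤ nuS X * 2 ^ spread X := by
  refine pseudoCharacter_le fun x => ?_
  obtain ⟨S, hSc, hSo, hST⟩ := exists_openNhds_inter_subset_thetaClos x
  have hs : ℵ₀ ≤ 2 ^ spread X := (le_self_add : ℵ₀ ≤ spread X).trans (cantor _).le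
  have hn : 1 ≤ nuS X := le_self_add
  refine ⟨S ∪ (fun y => {y}ᶜ) '' (thetaClosSingleton X x \ {x}), ?_, ?_, ?_⟩
  · refine (mk_union_le _ _).trans (add_le_of_le (hs.trans (le_mul_of_one_le_left' hn)) ?_ ?_)
    · exact hSc.trans (le_mul_of_one_le_left' hn)
    · calc _ ≤ #(thetaClosSingleton X x \ {x} : Set X) := mk_image_le
        _ ≤ #(thetaClosSingleton X x) := mk_le_mk_of_subset sdiff_subset
        _ ≤ nuS X := mk_thetaClosSingleton_le_nuS x
        _ ≤ nuS X * 2 ^ spread X := le_mul_of_one_le_right' (one_le_aleph0.trans hs)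
  · rintro _ (hV | ⟨y, -, rfl⟩)
    · exact (hSo _ hV).1
    · exact isOpen_compl_singleton
  · refine Subset.antisymm (fun y hy => ?_) ?_
    · by_contra hyx
      exact hy _ (.inr ⟨y, ⟨hST fun V hV => hy V (.inl hV), hyx⟩, rfl⟩) rfl
    · rintro _ rfl _ (hV | ⟨y, hy, rfl⟩)
      · exact (hSo _ hV).2
      · exact fun h => hy.2 h.symm
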